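/- arXiv:1209.5819 — 2 statements merged into one kernel-verified Lean document; each statement's English description precedes it below -/
import Mathlib

section
/- Let c : ℕ → ℝ be a sequence with c n ≥ 1 for all n, and let ℓ∞ denote the space of bounded real sequences with the supremum norm. Let A be the subset of ℓ∞ consisting of those x for which sup_n (c n · |x n|) < ∞. Then the closure of A in ℓ∞ is exactly the set of x ∈ ℓ∞ such that for every ε > 0 there exists N ∈ ℝ with |x n| ≤ ε for every n with c n ≥ N. -/
open scoped ENNReal

/-- The closure in `ℓ∞` of the set of bounded sequences `x` with
`sup_n (c n * |x n|) < ∞` (i.e. the set of such products is bounded above)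
is exactly the set of `x ∈ ℓ∞` such that for every `ε > 0` there is `N : ℝ`
with `|x n| ≤ ε` for every `n` with `c n ≥ N`. -/
theorem closure_weighted_bounded_in_linfty (c : ℕ → ℝ) (hc : ∀ n, 1 ≤ c n) :
    closure {x : lp (fun _ : ℕ => ℝ) ∞ | ∃ K : ℝ, ∀ n, c n * |x n| ≤ K} =
      {x : lp (fun _ : ℕ => ℝ) ∞ | ∀ ε > 0, ∃ N : ℝ, ∀ n, N ≤ c n → |x n| ≤ ε} := by
  ext x
  simp only [Metric.mem_closure_iff, Set.mem_ofPred_eq]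
  constructor
  · intro h ε hε
    obtain ⟨y, ⟨K, hK⟩, hxy⟩ := h (ε / 2) (half_pos hε)
    refine ⟨K / (ε / 2), fun n hn => ?_⟩
    have hdist : |x n - y n| < ε / 2 :=
      (lp.norm_apply_le_norm ENNReal.top_ne_zero (x - y) n).trans_lt (by rwa [← dist_eq_norm])
    have hy : |y n| ≤ ε / 2 := by
      have hcn : K ≤ c n * (ε / 2) := (div_le_iff₀ (half_pos hε)).mp hn
      exact le_of_mul_le_mul_left ((hK n).trans hcn) (one_pos.trans_le (hc n))
    linarith [abs_sub_abs_le_abs_sub (x n) (y n)]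
  · intro h ε hε
    obtain ⟨N, hN⟩ := h (ε / 2) (half_pos hε)
    have hx : ∀ n, |x n| ≤ ‖x‖ := lp.norm_apply_le_norm ENNReal.top_ne_zero x
    have hmem : Memℓp (fun n => if N ≤ c n then (0 : ℝ) else x n) ∞ := by
      refine memℓp_infty ⟨‖x‖, ?_⟩
      rintro _ ⟨n, rfl⟩
      dsimp only
      split_ifs
      · simp
      · exact hx n
    refine ⟨⟨_, hmem⟩, ⟨|N| * ‖x‖, fun n => ?_⟩, ?_⟩
    · dsimp only
      split_ifs with hn
      · simpa using mul_nonneg (abs_nonneg N) (norm_nonneg x)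
      · exact mul_le_mul ((not_le.mp hn).le.trans (le_abs_self N)) (hx n) (abs_nonneg _)
          (abs_nonneg N)
    · rw [dist_eq_norm]
      refine (lp.norm_le_of_forall_le (half_pos hε).le fun n => ?_).trans_lt (half_lt_self hε)
      change |x n - if N ≤ c n then (0 : ℝ) else x n| ≤ ε / 2
      split_ifs with hn
      · simpa using hN n hn
      · simpa using (half_pos hε).le
end

section
/- Let 0 < ε < 1, let l > 0, and let a, b be real numbers with 1 ≤ a ≤ e^l and −e^l ≤ b < 0. Set k = ⌊(1/l) · log((1+ε)/(1−ε))⌋ + 2, where ⌊·⌋ is the integer floor. Then (a · e^{k·l} + b) / (a · e^{k·l} − b) ≥ ε. -/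
/-- After `k = ⌊(1/l) * log ((1+ε)/(1-ε))⌋ + 2` full twists, the cosine
`(a * e^{k l} + b) / (a * e^{k l} - b)` of the angle with the imaginary axis is
at least `ε`, when `1 ≤ a ≤ e^l` and `-e^l ≤ b < 0`. -/
theorem twist_cosine_bound (ε l a b : ℝ) (hε : 0 < ε) (hε1 : ε < 1) (hl : 0 < l)
    (ha1 : 1 ≤ a) (ha2 : a ≤ Real.exp l) (hb1 : -Real.exp l ≤ b) (hb2 : b < 0) :
    ε ≤ (a * Real.exp ((⌊(1 / l) * Real.log ((1 + ε) / (1 - ε))⌋ + 2 : ℤ) * l) + b) /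
        (a * Real.exp ((⌊(1 / l) * Real.log ((1 + ε) / (1 - ε))⌋ + 2 : ℤ) * l) - b) := by
  have hpos : 0 < 1 - ε := sub_pos.2 hε1
  have hr : 0 < (1 + ε) / (1 - ε) := by positivity
  set k : ℤ := ⌊(1 / l) * Real.log ((1 + ε) / (1 - ε))⌋ + 2 with hk
  have hfloor : (1 / l) * Real.log ((1 + ε) / (1 - ε)) + 1 ≤ (k : ℝ) := by
    rw [hk]
    push_cast
    linarith [Int.lt_floor_add_one ((1 / l) * Real.log ((1 + ε) / (1 - ε)))]
  have hexp : (1 + ε) / (1 - ε) * Real.exp l ≤ Real.exp (k * l) := by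
    rw [← Real.exp_log hr, ← Real.exp_add, Real.exp_le_exp]
    calc Real.log ((1 + ε) / (1 - ε)) + l
        = ((1 / l) * Real.log ((1 + ε) / (1 - ε)) + 1) * l := by field_simp
      _ ≤ k * l := by gcongr
  rw [div_mul_eq_mul_div, div_le_iff₀ hpos] at hexp
  have hE := Real.exp_pos (k * l)
  have haE : Real.exp (k * l) ≤ a * Real.exp (k * l) := le_mul_of_one_le_left hE.le ha1
  rw [le_div_iff₀ (by linarith)]
  nlinarith [mul_le_mul_of_nonneg_right haE hpos.le]
end
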